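/- arXiv:2307.12581 — 2 statements merged into one kernel-verified Lean document; each statement's English description precedes it below -/
import Mathlib

section
/- Fix η > 0 and ε ∈ [0,1]. Let (P_n)_{n≥1} be a sequence of orthogonal projection matrices P_n ∈ ℝ^{n×n} (P_n = P_nᵀ = P_n²) and (x_n) a sequence with x_n ∈ {−1,1}ⁿ and ‖P_n x_n‖² ≥ (1−ε²)n for all n. Then liminf_{n→∞} p(ηP_n) ≥ η/2 − log 2 + sup_{x ∈ [0,1]} { H(x) + 2ηx² − 2ηx } − εη. -/
open MeasureTheory Matrix Real Filter

/-- The quadratic form `xᵀ J x`. -/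
noncomputable def qf {n : ℕ} (J : Matrix (Fin n) (Fin n) ℝ) (x : Fin n → ℝ) : ℝ :=
  ∑ i, ∑ j, x i * J i j * x j

/-- The `±1` vector associated to a boolean vector; these enumerate `{-1,1}ⁿ`. -/
noncomputable def sgn {n : ℕ} (b : Fin n → Bool) : Fin n → ℝ :=
  fun i => if b i then 1 else -1

/-- Normalized Ising partition function `Ẑ(J) = 2⁻ⁿ ∑_{x ∈ {-1,1}ⁿ} exp(½ xᵀJx)`. -/
noncomputable def isingZ {n : ℕ} (J : Matrix (Fin n) (Fin n) ℝ) : ℝ :=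
  ((2 : ℝ) ^ n)⁻¹ * ∑ b : Fin n → Bool, Real.exp ((1 / 2) * qf J (sgn b))

/-- Ising pressure `p(J) = n⁻¹ log Ẑ(J)`. -/
noncomputable def isingP {n : ℕ} (J : Matrix (Fin n) (Fin n) ℝ) : ℝ :=
  (n : ℝ)⁻¹ * Real.log (isingZ J)

/-- The binary entropy function `H(x) = -x log x - (1-x) log (1-x)`
(with the convention `log 0 = 0`, so `H 0 = H 1 = 0`). -/
noncomputable def binH (x : ℝ) : ℝ := -x * Real.log x - (1 - x) * Real.log (1 - x)

/-- Weight of the boolean value `c` under the Bernoulli law with parameter `q`. -/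
noncomputable def bernoulliWeight (q : ℝ) (c : Bool) : ℝ := if c then q else 1 - q

/-- Weight of a boolean vector under the product of Bernoulli laws with parameters `p i`. -/
noncomputable def productWeight {n : ℕ} (p : Fin n → ℝ) (b : Fin n → Bool) : ℝ :=
  ∏ i, bernoulliWeight (p i) (b i)

lemma bernoulliWeight_nonneg {q : ℝ} (hq : q ∈ Set.Icc (0 : ℝ) 1) (c : Bool) :
    0 ≤ bernoulliWeight q c := by
  have h0 := hq.1
  have h1 := hq.2
  cases c <;> simp [bernoulliWeight] <;> linarith

lemma productWeight_nonneg {n : ℕ} {p : Fin n → ℝ} (hp : ∀ i, p i ∈ Set.Icc (0 : ℝ) 1)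
    (b : Fin n → Bool) : 0 ≤ productWeight p b :=
  Finset.prod_nonneg fun i _ => bernoulliWeight_nonneg (hp i) (b i)

lemma sum_productWeight_mul_prod {n : ℕ} (p : Fin n → ℝ) (g : Fin n → Bool → ℝ) :
    ∑ b, productWeight p b * ∏ i, g i (b i) =
      ∏ i, (p i * g i true + (1 - p i) * g i false) := by
  have h := Finset.prod_univ_sum (fun _ : Fin n => (Finset.univ : Finset Bool))
    (fun i c => bernoulliWeight (p i) c * g i c)
  simp only [Fintype.piFinset_univ, Finset.prod_mul_distrib] at h
  rw [show ∑ b, productWeight p b * ∏ i, g i (b i) = _ from h.symm]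
  simp [bernoulliWeight]

lemma sum_productWeight {n : ℕ} (p : Fin n → ℝ) : ∑ b, productWeight p b = 1 := by
  simpa using sum_productWeight_mul_prod p (fun _ _ => 1)

lemma sum_productWeight_mul_apply {n : ℕ} (p : Fin n → ℝ) (i : Fin n) (g : Bool → ℝ) :
    ∑ b, productWeight p b * g (b i) = p i * g true + (1 - p i) * g false := by
  have h := sum_productWeight_mul_prod p (fun j c => if j = i then g c else 1)
  simp only [Finset.prod_ite_eq', Finset.mem_univ, if_true] at h
  rw [h, Finset.prod_eq_single i]
  · simp
  · intro j _ hj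
    simp [hj]
  · simp

lemma sum_productWeight_mul_sgn_mul_sgn {n : ℕ} (p : Fin n → ℝ) (i k : Fin n) :
    ∑ b, productWeight p b * (sgn b i * sgn b k) =
      if i = k then 1 else (2 * p i - 1) * (2 * p k - 1) := by
  split_ifs with hik
  · subst hik
    have hs (b : Fin n → Bool) : sgn b i * sgn b i = 1 := by
      unfold sgn
      split_ifs <;> norm_num
    simp [hs, sum_productWeight]
  · have h := sum_productWeight_mul_prod p (fun j c =>
      (if j = i then (if c then 1 else -1) else 1) * (if j = k then (if c then 1 else -1) else 1))
    simp only [Finset.prod_mul_distrib, Finset.prod_ite_eq', Finset.mem_univ, if_true] at h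
    have hprod : ∏ j, (p j * ((if j = i then (1 : ℝ) else 1) * (if j = k then 1 else 1)) +
        (1 - p j) * ((if j = i then (-1 : ℝ) else 1) * (if j = k then -1 else 1))) =
        ∏ j, ((if j = i then 2 * p j - 1 else 1) * (if j = k then 2 * p j - 1 else 1)) := by
      refine Finset.prod_congr rfl fun j _ => ?_
      by_cases hi : j = i
      · have hk : j ≠ k := fun e => hik (hi.symm.trans e)
        simp only [hi, hik, if_true, if_false]
        ring
      · simp only [hi, if_false]
        split_ifs <;> ring
    simp only [Bool.false_eq_true, if_false] at h
    rw [hprod, Finset.prod_mul_distrib] at h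
    simpa [sgn] using h

/-- The mean of the quadratic form under a product law, for nonnegative diagonals, is at least
the quadratic form of the mean. -/
lemma qf_mean_le {n : ℕ} (J : Matrix (Fin n) (Fin n) ℝ) (hJ : ∀ i, 0 ≤ J i i)
    (p : Fin n → ℝ) (hp : ∀ i, p i ∈ Set.Icc (0 : ℝ) 1) :
    qf J (fun i => 2 * p i - 1) ≤ ∑ b, productWeight p b * qf J (sgn b) := by
  have h : ∑ b, productWeight p b * qf J (sgn b) =
      ∑ i, ∑ k, J i k * ∑ b, productWeight p b * (sgn b i * sgn b k) := by
    simp only [qf, Finset.mul_sum]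
    rw [Finset.sum_comm]
    refine Finset.sum_congr rfl fun i _ => ?_
    rw [Finset.sum_comm]
    refine Finset.sum_congr rfl fun k _ => Finset.sum_congr rfl fun b _ => ?_
    ring
  rw [h]
  refine Finset.sum_le_sum fun i _ => Finset.sum_le_sum fun k _ => ?_
  rw [sum_productWeight_mul_sgn_mul_sgn]
  split_ifs with hik
  · subst hik
    nlinarith [hJ i, mul_nonneg (hJ i) (mul_nonneg (hp i).1 (sub_nonneg.2 (hp i).2))]
  · exact le_of_eq (by ring)

lemma sum_productWeight_mul_log {n : ℕ} (p : Fin n → ℝ) :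
    ∑ b, productWeight p b * Real.log (productWeight p b) = -∑ i, binH (p i) := by
  have h (b : Fin n → Bool) : productWeight p b * Real.log (productWeight p b) =
      ∑ i, productWeight p b * Real.log (bernoulliWeight (p i) (b i)) := by
    by_cases h0 : productWeight p b = 0
    · simp [h0]
    · rw [← Finset.mul_sum]
      congr 1
      exact Real.log_prod fun i hi => Finset.prod_ne_zero_iff.1 h0 i hi
  simp only [h]
  rw [Finset.sum_comm, ← Finset.sum_neg_distrib]
  refine Finset.sum_congr rfl fun i _ => ?_
  rw [sum_productWeight_mul_apply p i (fun c => Real.log (bernoulliWeight (p i) c))]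
  simp only [bernoulliWeight, binH, if_true, Bool.false_eq_true, if_false]
  ring

/-- Gibbs variational lower bound for the log-sum-exp function. -/
lemma sum_mul_sub_log_le_log_sum_exp {ι : Type*} [Fintype ι] (w f : ι → ℝ)
    (hw : ∀ i, 0 ≤ w i) (hw1 : ∑ i, w i = 1) :
    ∑ i, w i * (f i - Real.log (w i)) ≤ Real.log (∑ i, Real.exp (f i)) := by
  have hJensen := convexOn_exp.map_sum_le (t := Finset.univ) (w := w)
    (p := fun i => f i - Real.log (w i)) (fun i _ => hw i) hw1 (fun _ _ => Set.mem_univ _)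
  simp only [smul_eq_mul] at hJensen
  have hle : ∑ i, w i * Real.exp (f i - Real.log (w i)) ≤ ∑ i, Real.exp (f i) := by
    refine Finset.sum_le_sum fun i _ => ?_
    rcases (hw i).eq_or_lt with h0 | hpos
    · rw [← h0, zero_mul]
      positivity
    · rw [Real.exp_sub, Real.exp_log hpos, mul_div_cancel₀ _ hpos.ne']
  have h := hJensen.trans hle
  exact (Real.le_log_iff_exp_le ((Real.exp_pos _).trans_le h)).2 h

/-- Mean-field lower bound on the log-partition function. -/
lemma meanField_le_log_isingZ {n : ℕ} (J : Matrix (Fin n) (Fin n) ℝ) (hJ : ∀ i, 0 ≤ J i i)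
    (p : Fin n → ℝ) (hp : ∀ i, p i ∈ Set.Icc (0 : ℝ) 1) :
    ∑ i, binH (p i) + (1 / 2) * qf J (fun i => 2 * p i - 1) - n * Real.log 2 ≤
      Real.log (isingZ J) := by
  have hG := sum_mul_sub_log_le_log_sum_exp (productWeight p) (fun b => (1 / 2) * qf J (sgn b))
    (productWeight_nonneg hp) (sum_productWeight p)
  simp only [mul_sub, Finset.sum_sub_distrib, sum_productWeight_mul_log] at hG
  have hq := qf_mean_le J hJ p hp
  have hs : ∑ b, productWeight p b * ((1 / 2) * qf J (sgn b)) =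
      (1 / 2) * ∑ b, productWeight p b * qf J (sgn b) := by
    rw [Finset.mul_sum]
    exact Finset.sum_congr rfl fun b _ => by ring
  have hpos : 0 < ∑ b : Fin n → Bool, Real.exp ((1 / 2) * qf J (sgn b)) :=
    Finset.sum_pos (fun _ _ => Real.exp_pos _) Finset.univ_nonempty
  rw [isingZ, Real.log_mul (by positivity) hpos.ne', Real.log_inv, Real.log_pow]
  linarith

lemma qf_eq_dotProduct {n : ℕ} (J : Matrix (Fin n) (Fin n) ℝ) (y : Fin n → ℝ) :
    qf J y = y ⬝ᵥ J *ᵥ y := by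
  simp only [qf, dotProduct, mulVec, Finset.mul_sum, mul_assoc]

lemma qf_smul {n : ℕ} (c : ℝ) (J : Matrix (Fin n) (Fin n) ℝ) (y : Fin n → ℝ) :
    qf (c • J) y = c * qf J y := by
  simp [qf_eq_dotProduct, smul_mulVec]

lemma qf_projection {n : ℕ} {Q : Matrix (Fin n) (Fin n) ℝ} (hs : Qᵀ = Q) (hp : Q * Q = Q)
    (y : Fin n → ℝ) : qf Q y = ∑ i, (Q *ᵥ y) i ^ 2 := by
  have h : (Q *ᵥ y) ⬝ᵥ (Q *ᵥ y) = y ⬝ᵥ Q *ᵥ y := by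
    rw [dotProduct_mulVec, ← mulVec_transpose, hs, mulVec_mulVec, hp, dotProduct_comm]
  rw [qf_eq_dotProduct, ← h]
  simp [dotProduct, sq]

lemma projection_diag_nonneg {n : ℕ} {Q : Matrix (Fin n) (Fin n) ℝ} (hs : Qᵀ = Q)
    (hp : Q * Q = Q) (i : Fin n) : 0 ≤ Q i i := by
  have h : Q i i = ∑ j, Q i j * Q i j := by
    conv_lhs => rw [← hp, Matrix.mul_apply]
    refine Finset.sum_congr rfl fun j _ => ?_
    rw [show Q j i = Q i j from congrFun (congrFun hs i) j]
  rw [h]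
  exact Finset.sum_nonneg fun j _ => mul_self_nonneg _

lemma qf_projection_sgn_le {n : ℕ} {Q : Matrix (Fin n) (Fin n) ℝ} (hs : Qᵀ = Q) (hp : Q * Q = Q)
    (b : Fin n → Bool) : qf Q (sgn b) ≤ n := by
  have hp' : (1 - Q) * (1 - Q) = 1 - Q := by
    rw [sub_mul, mul_sub, mul_sub, hp]
    simp
  have h0 : 0 ≤ qf (1 - Q) (sgn b) := by
    rw [qf_projection (by simp [hs]) hp']
    positivity
  have h1 : sgn b ⬝ᵥ sgn b = n := by
    have hb (i : Fin n) : sgn b i * sgn b i = 1 := by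
      unfold sgn
      split_ifs <;> norm_num
    simp [dotProduct, hb]
  rw [qf_eq_dotProduct, sub_mulVec, one_mulVec, dotProduct_sub, h1, ← qf_eq_dotProduct] at h0
  linarith

lemma isingP_smul_projection_le {n : ℕ} {Q : Matrix (Fin n) (Fin n) ℝ} (hs : Qᵀ = Q)
    (hp : Q * Q = Q) {η : ℝ} (hη : 0 ≤ η) : isingP (η • Q) ≤ η / 2 := by
  have hpos : 0 < isingZ (η • Q) :=
    mul_pos (by positivity) (Finset.sum_pos (fun _ _ => Real.exp_pos _) Finset.univ_nonempty)
  have hZ : isingZ (η • Q) ≤ Real.exp (η / 2 * n) := by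
    have hsum : ∑ b : Fin n → Bool, Real.exp ((1 / 2) * qf (η • Q) (sgn b)) ≤
        2 ^ n * Real.exp (η / 2 * n) := by
      refine (Finset.sum_le_card_nsmul _ _ (Real.exp (η / 2 * n)) fun b _ => ?_).trans ?_
      · rw [Real.exp_le_exp, qf_smul]
        nlinarith [mul_le_mul_of_nonneg_left (qf_projection_sgn_le hs hp b) hη]
      · simp
    rw [isingZ, inv_mul_le_iff₀ (by positivity)]
    exact hsum
  have hlog : Real.log (isingZ (η • Q)) ≤ η / 2 * n := (Real.log_le_iff_le_exp hpos).2 hZ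
  rcases Nat.eq_zero_or_pos n with rfl | hn
  · simp [isingP]
    positivity
  · have hn' : (0 : ℝ) < n := by exact_mod_cast hn
    rw [isingP, inv_mul_le_iff₀ hn']
    linarith

/-- Mean-field bound for the pressure of a projection with an almost invariant sign vector. -/
lemma le_isingP_smul_projection {n : ℕ} (hn : 0 < n) {Q : Matrix (Fin n) (Fin n) ℝ}
    (hs : Qᵀ = Q) (hp : Q * Q = Q) {η δ t : ℝ} (hη : 0 ≤ η) (ht : t ∈ Set.Icc (0 : ℝ) 1)
    {y : Fin n → ℝ} (hy : ∀ i, y i = 1 ∨ y i = -1)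
    (hQy : (1 - δ) * n ≤ ∑ i, (Q *ᵥ y) i ^ 2) :
    binH t + η / 2 * ((1 - 2 * t) ^ 2 * (1 - δ)) - Real.log 2 ≤ isingP (η • Q) := by
  have hn' : (0 : ℝ) < n := by exact_mod_cast hn
  have h := meanField_le_log_isingZ (η • Q)
    (fun i => mul_nonneg hη (projection_diag_nonneg hs hp i))
    (fun i => (1 + (1 - 2 * t) * y i) / 2) (fun i => by
      obtain ⟨h0, h1⟩ := ht
      rcases hy i with h | h <;> rw [h] <;> constructor <;> linarith)
  have hH (i : Fin n) : binH ((1 + (1 - 2 * t) * y i) / 2) = binH t := by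
    rcases hy i with h | h
    · rw [h, show (1 + (1 - 2 * t) * 1) / 2 = 1 - t by ring, binH, binH, sub_sub_cancel]
      ring
    · rw [h, show (1 + (1 - 2 * t) * -1) / 2 = t by ring]
  have hmean : (fun i => 2 * ((1 + (1 - 2 * t) * y i) / 2) - 1) = (1 - 2 * t) • y := by
    ext i
    simp only [Pi.smul_apply, smul_eq_mul]
    ring
  have hqf : qf Q ((1 - 2 * t) • y) = (1 - 2 * t) ^ 2 * ∑ i, (Q *ᵥ y) i ^ 2 := by
    rw [← qf_projection hs hp, qf_eq_dotProduct, qf_eq_dotProduct, mulVec_smul, smul_dotProduct,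
      dotProduct_smul, smul_eq_mul, smul_eq_mul]
    ring
  simp only [hH, hmean, qf_smul, hqf, Finset.sum_const, Finset.card_univ, Fintype.card_fin,
    nsmul_eq_mul] at h
  have hm := mul_le_mul_of_nonneg_left
    (mul_le_mul_of_nonneg_left hQy (sq_nonneg (1 - 2 * t))) hη
  rw [isingP, le_inv_mul_iff₀ hn']
  linarith

/-- If `Pₙ` are orthogonal projections and `xₙ ∈ {-1,1}ⁿ` with `‖Pₙxₙ‖² ≥ (1-ε²)n`, then
`liminf_n p(ηPₙ) ≥ η/2 - log 2 + sup_{x ∈ [0,1]} { H(x) + 2ηx² - 2ηx } - εη`. -/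
theorem stmt_10 (η ε : ℝ) (hη : 0 < η) (hε : ε ∈ Set.Icc (0 : ℝ) 1)
    (P : ∀ n : ℕ, Matrix (Fin n) (Fin n) ℝ)
    (hPsymm : ∀ n, (P n)ᵀ = P n) (hPproj : ∀ n, P n * P n = P n)
    (x : ∀ n : ℕ, Fin n → ℝ) (hx : ∀ n i, x n i = 1 ∨ x n i = -1)
    (hPx : ∀ n : ℕ, (1 - ε ^ 2) * n ≤ ∑ i, ((P n).mulVec (x n) i) ^ 2) :
    η / 2 - Real.log 2 +
        (⨆ t : Set.Icc (0 : ℝ) 1, (binH t + 2 * η * (t : ℝ) ^ 2 - 2 * η * t)) - ε * η ≤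
      Filter.liminf (fun n : ℕ => isingP (η • P n)) atTop := by
  have hbdd : ∀ᶠ n in atTop, isingP (η • P n) ≤ η / 2 :=
    Eventually.of_forall fun n => isingP_smul_projection_le (hPsymm n) (hPproj n) hη.le
  have hcobdd : IsCoboundedUnder (· ≥ ·) atTop (fun n : ℕ => isingP (η • P n)) :=
    IsBoundedUnder.isCoboundedUnder_ge ⟨η / 2, by simpa using hbdd⟩
  suffices h : (⨆ t : Set.Icc (0 : ℝ) 1, (binH t + 2 * η * (t : ℝ) ^ 2 - 2 * η * t)) ≤
      Filter.liminf (fun n : ℕ => isingP (η • P n)) atTop - (η / 2 - Real.log 2 - ε * η) by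
    linarith
  have : Nonempty (Set.Icc (0 : ℝ) 1) := ⟨⟨0, by simp⟩⟩
  refine ciSup_le fun t => ?_
  rw [le_sub_iff_add_le]
  refine le_liminf_of_le hcobdd ?_
  filter_upwards [eventually_gt_atTop 0] with n hn
  refine le_trans ?_ (le_isingP_smul_projection hn (hPsymm n) (hPproj n) hη.le t.2 (hx n) (hPx n))
  obtain ⟨ht0, ht1⟩ := t.2
  obtain ⟨hε0, hε1⟩ := hε
  have hm : (1 - 2 * (t : ℝ)) ^ 2 ≤ 1 := by nlinarith
  have hloss : (1 - 2 * (t : ℝ)) ^ 2 * ε ^ 2 ≤ 2 * ε := by nlinarith [sq_nonneg ε]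
  nlinarith [mul_le_mul_of_nonneg_left hloss hη.le]
end

section
/- Let n ≥ k ≥ 1, let η > 0, and let U, V ∈ ℝ^{n×k} be matrices with orthonormal columns (UᵀU = VᵀV = I_k). Then |p(ηUUᵀ) − p(ηVVᵀ)| ≤ η ‖U − V‖_F, where ‖·‖_F is the Frobenius norm; i.e., the map U ↦ p(ηUUᵀ) is η-Lipschitz with respect to the Frobenius norm on the set of n×k matrices with orthonormal columns. -/
open MeasureTheory Matrix Real Filter

/-- Frobenius norm of a real matrix. -/
noncomputable def frobNorm {m k : ℕ} (A : Matrix (Fin m) (Fin k) ℝ) : ℝ :=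
  Real.sqrt (∑ i, ∑ j, (A i j) ^ 2)

/-- The quadratic form of `η U Uᵀ` is `η ‖Uᵀ x‖²`. -/
lemma qf_smul_mul_transpose {n k : ℕ} (η : ℝ) (U : Matrix (Fin n) (Fin k) ℝ) (x : Fin n → ℝ) :
    qf (η • (U * Uᵀ)) x = η * ((Uᵀ *ᵥ x) ⬝ᵥ (Uᵀ *ᵥ x)) := by
  have h : qf (η • (U * Uᵀ)) x = x ⬝ᵥ ((η • (U * Uᵀ)) *ᵥ x) := by
    simp only [qf, dotProduct, mulVec, Finset.mul_sum, mul_assoc]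
  rw [h, smul_mulVec, dotProduct_smul, ← mulVec_mulVec, dotProduct_mulVec, ← mulVec_transpose,
    smul_eq_mul]

lemma sgn_dotProduct_self {n : ℕ} (b : Fin n → Bool) : sgn b ⬝ᵥ sgn b = n := by
  have h (i : Fin n) : sgn b i * sgn b i = 1 := by
    unfold sgn; split_ifs <;> norm_num
  simp [dotProduct, h]

lemma dotProduct_self_nonneg_real {m : ℕ} (x : Fin m → ℝ) : 0 ≤ x ⬝ᵥ x :=
  Finset.sum_nonneg fun i _ => mul_self_nonneg (x i)

/-- Bessel's inequality for a matrix with orthonormal columns. -/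
lemma transpose_mulVec_dotProduct_self_le {n k : ℕ} {U : Matrix (Fin n) (Fin k) ℝ}
    (hU : Uᵀ * U = 1) (x : Fin n → ℝ) : (Uᵀ *ᵥ x) ⬝ᵥ (Uᵀ *ᵥ x) ≤ x ⬝ᵥ x := by
  have h := dotProduct_self_nonneg_real (x - U *ᵥ (Uᵀ *ᵥ x))
  have h1 : x ⬝ᵥ (U *ᵥ (Uᵀ *ᵥ x)) = (Uᵀ *ᵥ x) ⬝ᵥ (Uᵀ *ᵥ x) := by
    rw [dotProduct_mulVec, ← mulVec_transpose]
  have h2 : (U *ᵥ (Uᵀ *ᵥ x)) ⬝ᵥ (U *ᵥ (Uᵀ *ᵥ x)) = (Uᵀ *ᵥ x) ⬝ᵥ (Uᵀ *ᵥ x) := by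
    rw [dotProduct_mulVec, ← mulVec_transpose, mulVec_mulVec, hU, one_mulVec]
  rw [sub_dotProduct, dotProduct_sub, dotProduct_sub, h2, dotProduct_comm (U *ᵥ _) x, h1] at h
  linarith

lemma transpose_mulVec_dotProduct_self_le_frobNorm {n k : ℕ} (A : Matrix (Fin n) (Fin k) ℝ)
    (x : Fin n → ℝ) : (Aᵀ *ᵥ x) ⬝ᵥ (Aᵀ *ᵥ x) ≤ frobNorm A ^ 2 * (x ⬝ᵥ x) := by
  have hF : frobNorm A ^ 2 = ∑ i, ∑ j, A i j ^ 2 :=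
    Real.sq_sqrt (Finset.sum_nonneg fun i _ => Finset.sum_nonneg fun j _ => sq_nonneg (A i j))
  rw [hF, Finset.sum_comm, Finset.sum_mul]
  refine Finset.sum_le_sum fun j _ => ?_
  have h := Finset.sum_mul_sq_le_sq_mul_sq Finset.univ (fun i => A i j) x
  simpa [mulVec, dotProduct, pow_two] using h

/-- On sign vectors the quadratic forms `xᵀUUᵀx` and `xᵀVVᵀx` differ by at most
`2 n ‖U - V‖_F`. -/
lemma abs_sub_dotProduct_self_le {n k : ℕ} {U V : Matrix (Fin n) (Fin k) ℝ}
    (hU : Uᵀ * U = 1) (hV : Vᵀ * V = 1) (x : Fin n → ℝ) (hx : x ⬝ᵥ x = n) :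
    |(Uᵀ *ᵥ x) ⬝ᵥ (Uᵀ *ᵥ x) - (Vᵀ *ᵥ x) ⬝ᵥ (Vᵀ *ᵥ x)| ≤ 2 * n * frobNorm (U - V) := by
  have ha := transpose_mulVec_dotProduct_self_le hU x
  have hb := transpose_mulVec_dotProduct_self_le hV x
  have hd := transpose_mulVec_dotProduct_self_le_frobNorm (U - V) x
  rw [transpose_sub, sub_mulVec] at hd
  rw [hx] at ha hb hd
  generalize Uᵀ *ᵥ x = a at *
  generalize Vᵀ *ᵥ x = b at *
  have hfac : a ⬝ᵥ a - b ⬝ᵥ b = (a - b) ⬝ᵥ (a + b) := by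
    rw [sub_dotProduct, dotProduct_add, dotProduct_add, dotProduct_comm b a]; ring
  have hs : (a + b) ⬝ᵥ (a + b) ≤ 4 * n := by
    have h0 := dotProduct_self_nonneg_real (a - b)
    simp only [sub_dotProduct, dotProduct_sub, add_dotProduct, dotProduct_add] at h0 ⊢
    linarith
  have hF : 0 ≤ frobNorm (U - V) := Real.sqrt_nonneg _
  have hcs : ((a - b) ⬝ᵥ (a + b)) ^ 2 ≤ ((a - b) ⬝ᵥ (a - b)) * ((a + b) ⬝ᵥ (a + b)) := by
    have h := Finset.sum_mul_sq_le_sq_mul_sq Finset.univ (a - b) (a + b)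
    simpa only [dotProduct, pow_two] using h
  rw [hfac]
  refine abs_le_of_sq_le_sq (hcs.trans ?_) (by positivity)
  calc _ ≤ (frobNorm (U - V) ^ 2 * n) * (4 * n) :=
        mul_le_mul hd hs (dotProduct_self_nonneg_real _) (by positivity)
    _ = _ := by ring

lemma isingZ_pos {n : ℕ} (J : Matrix (Fin n) (Fin n) ℝ) : 0 < isingZ J :=
  mul_pos (by positivity) (Finset.sum_pos (fun _ _ => Real.exp_pos _) Finset.univ_nonempty)

/-- The pressure is controlled by the pointwise difference of the quadratic forms. -/
lemma isingP_le_add {n : ℕ} (hn : 0 < n) {J K : Matrix (Fin n) (Fin n) ℝ} {c : ℝ}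
    (h : ∀ b : Fin n → Bool, qf J (sgn b) ≤ qf K (sgn b) + 2 * n * c) :
    isingP J ≤ isingP K + c := by
  have hZ : isingZ J ≤ isingZ K * Real.exp (n * c) := by
    unfold isingZ
    rw [mul_assoc, Finset.sum_mul]
    refine mul_le_mul_of_nonneg_left (Finset.sum_le_sum fun b _ => ?_) (by positivity)
    rw [← Real.exp_add]
    exact Real.exp_le_exp.mpr (by linarith [h b])
  have hlog := Real.log_le_log (isingZ_pos J) hZ
  rw [Real.log_mul (isingZ_pos K).ne' (Real.exp_pos _).ne', Real.log_exp] at hlog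
  have hn' : (0 : ℝ) < n := Nat.cast_pos.mpr hn
  calc isingP J ≤ (n : ℝ)⁻¹ * (Real.log (isingZ K) + n * c) :=
        mul_le_mul_of_nonneg_left hlog (by positivity)
    _ = isingP K + c := by unfold isingP; field_simp

/-- For `U, V` with orthonormal columns and `η > 0`,
`|p(ηUUᵀ) - p(ηVVᵀ)| ≤ η ‖U - V‖_F`: the map `U ↦ p(ηUUᵀ)` is `η`-Lipschitz in the
Frobenius norm on matrices with orthonormal columns. -/
theorem stmt_12 {n k : ℕ} (hk : 1 ≤ k) (hkn : k ≤ n) (η : ℝ) (hη : 0 < η)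
    (U V : Matrix (Fin n) (Fin k) ℝ) (hU : Uᵀ * U = 1) (hV : Vᵀ * V = 1) :
    |isingP (η • (U * Uᵀ)) - isingP (η • (V * Vᵀ))| ≤ η * frobNorm (U - V) := by
  have hn : 0 < n := hk.trans hkn
  have key (b : Fin n → Bool) :
      |qf (η • (U * Uᵀ)) (sgn b) - qf (η • (V * Vᵀ)) (sgn b)|
        ≤ 2 * n * (η * frobNorm (U - V)) := by
    rw [qf_smul_mul_transpose, qf_smul_mul_transpose, ← mul_sub, abs_mul, abs_of_pos hη]
    calc _ ≤ η * (2 * n * frobNorm (U - V)) :=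
          mul_le_mul_of_nonneg_left
            (abs_sub_dotProduct_self_le hU hV _ (sgn_dotProduct_self b)) hη.le
      _ = _ := by ring
  have h1 := isingP_le_add hn (J := η • (U * Uᵀ)) (K := η • (V * Vᵀ))
    (c := η * frobNorm (U - V))
    fun b => by linarith [(abs_le.mp (key b)).2]
  have h2 := isingP_le_add hn (J := η • (V * Vᵀ)) (K := η • (U * Uᵀ))
    (c := η * frobNorm (U - V))
    fun b => by linarith [(abs_le.mp (key b)).1]
  exact abs_le.mpr ⟨by linarith, by linarith⟩
end
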